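/- Let 𝒜 be a semi-abelian category and let f: X→Y and g: Z→Y be central extensions with kernels a: A→X and b: B→Z respectively. Form the pullback W = X×_Y Z of f along g, with projections q₁: W→X and q₂: W→Z, and let h = f∘q₁ = g∘q₂: W→Y. Then h is a central extension, and the unique morphism A×B→W determined by q₁∘(A×B→W) = a∘π_A and q₂∘(A×B→W) = b∘π_B (where π_A, π_B are the product projections of A×B) is a kernel of h. -/

import Mathlib

open CategoryTheory CategoryTheory.Limits

universe v u

section Defs

variable {C : Type u} [Category.{v} C]

/-- A finitely complete category is protomodular if, for every commutative diagram of two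
adjacent commutative squares in which the middle vertical morphism is a split epimorphism,
whenever the left-hand square and the outer rectangle are pullbacks, so is the right-hand
square. -/
def Protomodular (C : Type u) [Category.{v} C] : Prop :=
  ∀ ⦃A B D A' B' D' : C⦄ (f : A ⟶ B) (g : B ⟶ D)
    (f' : A' ⟶ B') (g' : B' ⟶ D')
    (a : A ⟶ A') (b : B ⟶ B') (d : D ⟶ D'),
    g ≫ d = b ≫ g' →
    IsSplitEpi b →
    IsPullback f a b f' →
    IsPullback (f ≫ g) a d (f' ≫ g') →
    IsPullback g b d g'

variable [HasZeroMorphisms C] [HasFiniteLimits C]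

/-- Two coterminal morphisms `k`, `k'` cooperate (commute in the sense of Huq) when there is
a morphism `φ : K ⨯ K' ⟶ X` restricting to `k` and `k'` along `(1,0)` and `(0,1)`. -/
def Cooperate {K K' X : C} (k : K ⟶ X) (k' : K' ⟶ X) : Prop :=
  ∃ φ : K ⨯ K' ⟶ X, prod.lift (𝟙 K) 0 ≫ φ = k ∧ prod.lift 0 (𝟙 K') ≫ φ = k'

/-- A morphism is central in the sense of Huq when it cooperates with the identity. -/
def HuqCentral {K X : C} (k : K ⟶ X) : Prop :=
  Cooperate k (𝟙 X)

/-- An object is abelian when its identity cooperates with itself. -/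
def IsAbelianObj (A : C) : Prop :=
  Cooperate (𝟙 A) (𝟙 A)

/-- `k` is a kernel of `f`. -/
def IsKernelOf {K X Y : C} (k : K ⟶ X) (f : X ⟶ Y) : Prop :=
  ∃ w : k ≫ f = 0, Nonempty (IsLimit (KernelFork.ofι k w))

/-- A central extension is a regular epimorphism whose kernel is Huq-central. -/
def IsCentralExt {X Y : C} (f : X ⟶ Y) : Prop :=
  Nonempty (RegularEpi f) ∧ HuqCentral (kernel.ι f)

/-- A normal monomorphism: a morphism that is a kernel of some morphism. -/
def IsNormalMonoP {K X : C} (m : K ⟶ X) : Prop :=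
  ∃ (Z : C) (g : X ⟶ Z), IsKernelOf m g

/-- `(p₁, p₂) : R ↣ X ⨯ X` is an internal equivalence relation. -/
structure IsEquivRelation {R X : C} (p₁ p₂ : R ⟶ X) : Prop where
  mono : Mono (prod.lift p₁ p₂)
  refl : ∃ d : X ⟶ R, d ≫ p₁ = 𝟙 X ∧ d ≫ p₂ = 𝟙 X
  symm : ∃ s : R ⟶ R, s ≫ p₁ = p₂ ∧ s ≫ p₂ = p₁
  trans : ∃ t : pullback p₂ p₁ ⟶ R,
    t ≫ p₁ = pullback.fst p₂ p₁ ≫ p₁ ∧ t ≫ p₂ = pullback.snd p₂ p₁ ≫ p₂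

end Defs

/-- A semi-abelian category: pointed, Barr-exact (regular with effective equivalence
relations), protomodular and with binary coproducts. -/
class SemiAbelian (C : Type u) [Category.{v} C] [HasZeroMorphisms C] [HasZeroObject C]
    [HasFiniteLimits C] [HasBinaryCoproducts C] : Prop where
  /-- Every kernel pair has a coequalizer. -/
  hasCoeqOfKernelPair : ∀ {X Y : C} (f : X ⟶ Y),
    HasCoequalizer (pullback.fst f f) (pullback.snd f f)
  /-- Regular epimorphisms are stable under pullback. -/
  regEpiPullbackStable : ∀ {X Y Z : C} (f : X ⟶ Z) (g : Y ⟶ Z),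
    Nonempty (RegularEpi g) → Nonempty (RegularEpi (pullback.fst f g))
  /-- Every internal equivalence relation is effective, i.e. a kernel pair. -/
  equivRelationEffective : ∀ {R X : C} (p₁ p₂ : R ⟶ X), IsEquivRelation p₁ p₂ →
    ∃ (Y : C) (f : X ⟶ Y), IsKernelPair f p₁ p₂
  /-- The category is protomodular. -/
  protomodular : Protomodular C

section Regularity

variable {C : Type u} [Category.{v} C] [HasZeroMorphisms C] [HasZeroObject C]
  [HasFiniteLimits C] [HasBinaryCoproducts C] [SemiAbelian C]

/-- A semi-abelian category is regular. -/
theorem SemiAbelian.regular : Regular C where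
  hasCoequalizer_of_isKernelPair {X Y Z f g₁ g₂} h := by
    have := SemiAbelian.hasCoeqOfKernelPair f
    exact hasColimit_of_iso (parallelPair.ext h.isoPullback (Iso.refl X) (by simp) (by simp) :
      parallelPair g₁ g₂ ≅ parallelPair (pullback.fst f f) (pullback.snd f f))
  regularEpiIsStableUnderBaseChange := by
    refine .mk' fun X Y S f g _ hg => ⟨?_⟩
    exact SemiAbelian.regEpiPullbackStable f g hg.regularEpi

theorem RegularEpi.nonempty_comp {X Y Z : C} {f : X ⟶ Y} {g : Y ⟶ Z}
    (hf : Nonempty (RegularEpi f)) (hg : Nonempty (RegularEpi g)) :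
    Nonempty (RegularEpi (f ≫ g)) := by
  have : Regular C := SemiAbelian.regular
  have : IsRegularEpi f := ⟨hf⟩
  have : IsRegularEpi g := ⟨hg⟩
  have := strongEpi_comp f g
  exact (inferInstance : IsRegularEpi (f ≫ g)).regularEpi

end Regularity

section Unital

variable {C : Type u} [Category.{v} C] [HasZeroMorphisms C] [HasZeroObject C]
  [HasFiniteLimits C]

open ZeroObject

/-- In a pointed protomodular category, a monomorphism into `K ⨯ X` through which both
`(1, 0)` and `(0, 1)` factor is an isomorphism. -/
theorem Protomodular.isIso_of_factors (hC : Protomodular C) {K X E : C} (e : E ⟶ K ⨯ X) [Mono e]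
    (i : K ⟶ E) (j : X ⟶ E) (hi : i ≫ e = prod.lift (𝟙 K) 0) (hj : j ≫ e = prod.lift 0 (𝟙 X)) :
    IsIso e := by
  have hi₁ : i ≫ e ≫ prod.fst = 𝟙 K := by rw [reassoc_of% hi, prod.lift_fst]
  have hi₂ : i ≫ e ≫ prod.snd = 0 := by rw [reassoc_of% hi, prod.lift_snd]
  have hj₂ : j ≫ e ≫ prod.snd = 𝟙 X := by rw [reassoc_of% hj, prod.lift_snd]
  have h : IsPullback e (e ≫ prod.snd) prod.snd (𝟙 X) := by
    refine hC i e (0 : (0 : C) ⟶ X) (𝟙 X) (0 : K ⟶ 0) (e ≫ prod.snd) prod.snd (by simp)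
      ⟨⟨j, hj₂⟩⟩ ?_ ?_
    · refine ⟨⟨by simp [hi₂]⟩, ⟨PullbackCone.IsLimit.mk _ (fun s => s.fst ≫ e ≫ prod.fst) ?_ ?_ ?_⟩⟩
      · intro s
        have hs : s.fst ≫ e ≫ prod.snd = 0 := by rw [s.condition, comp_zero]
        rw [← cancel_mono e]
        ext <;> simp [hi, hs, prod.lift_fst, prod.lift_snd]
      · intro s
        exact (isZero_zero C).eq_of_tgt _ _
      · intro s m hm _
        rw [← hm]
        simp [hi₁]
    · refine ⟨⟨by simp [hi, prod.lift_snd]⟩, ⟨PullbackCone.IsLimit.mk _ (fun s => s.fst ≫ prod.fst) ?_ ?_ ?_⟩⟩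
      · intro s
        have hs : s.fst ≫ prod.snd = 0 := by
          simpa using s.condition
        ext <;> simp [hi, hs, prod.lift_fst, prod.lift_snd]
      · intro s
        exact (isZero_zero C).eq_of_tgt _ _
      · intro s m hm _
        rw [← hm]
        simp [hi₁]
  exact h.isIso_fst_of_isIso

/-- In a pointed protomodular category, `(1, 0)` and `(0, 1)` are jointly epimorphic. -/
theorem Protomodular.prod_hom_ext (hC : Protomodular C) {K X T : C} {p q : K ⨯ X ⟶ T}
    (h₁ : prod.lift (𝟙 K) 0 ≫ p = prod.lift (𝟙 K) 0 ≫ q)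
    (h₂ : prod.lift 0 (𝟙 X) ≫ p = prod.lift 0 (𝟙 X) ≫ q) : p = q := by
  have := hC.isIso_of_factors (equalizer.ι p q) (equalizer.lift _ h₁) (equalizer.lift _ h₂)
    (equalizer.lift_ι _ _) (equalizer.lift_ι _ _)
  exact eq_of_epi_equalizer

end Unital

section Pullback

variable {C : Type u} [Category.{v} C] [HasZeroMorphisms C] [HasFiniteLimits C]

/-- The diagonal of the pullback of two morphisms with central kernels has a central kernel. -/
theorem HuqCentral.kernel_pullback [HasZeroObject C] (hC : Protomodular C)
    {X Y Z : C} {f : X ⟶ Y} {g : Z ⟶ Y}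
    (hf : HuqCentral (kernel.ι f)) (hg : HuqCentral (kernel.ι g)) :
    HuqCentral (kernel.ι (pullback.fst f g ≫ f)) := by
  obtain ⟨φ, hφ₁, hφ₂⟩ := hf
  obtain ⟨ψ, hψ₁, hψ₂⟩ := hg
  have hφ : φ ≫ f = prod.snd ≫ f := by
    apply hC.prod_hom_ext
    · simp [reassoc_of% hφ₁, prod.lift_snd_assoc]
    · simp [reassoc_of% hφ₂, prod.lift_snd_assoc]
  have hψ : ψ ≫ g = prod.snd ≫ g := by
    apply hC.prod_hom_ext
    · simp [reassoc_of% hψ₁, prod.lift_snd_assoc]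
    · simp [reassoc_of% hψ₂, prod.lift_snd_assoc]
  let ι := kernel.ι (pullback.fst f g ≫ f)
  let u : kernel (pullback.fst f g ≫ f) ⟶ kernel f :=
    kernel.lift f (ι ≫ pullback.fst f g) (by simp [ι, kernel.condition])
  let w : kernel (pullback.fst f g ≫ f) ⟶ kernel g :=
    kernel.lift g (ι ≫ pullback.snd f g)
      (by rw [Category.assoc, ← pullback.condition]; exact kernel.condition _)
  have hu : prod.lift (𝟙 _) 0 ≫ prod.map u (pullback.fst f g) = u ≫ prod.lift (𝟙 _) 0 := by
    ext <;> simp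
  have hw : prod.lift (𝟙 _) 0 ≫ prod.map w (pullback.snd f g) = w ≫ prod.lift (𝟙 _) 0 := by
    ext <;> simp
  have hu' : prod.lift 0 (𝟙 _) ≫ prod.map u (pullback.fst f g) =
      pullback.fst f g ≫ prod.lift 0 (𝟙 _) := by
    ext <;> simp
  have hw' : prod.lift 0 (𝟙 _) ≫ prod.map w (pullback.snd f g) =
      pullback.snd f g ≫ prod.lift 0 (𝟙 _) := by
    ext <;> simp
  refine ⟨pullback.lift (prod.map u (pullback.fst f g) ≫ φ) (prod.map w (pullback.snd f g) ≫ ψ)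
    ?_, ?_, ?_⟩
  · simp [hφ, hψ, pullback.condition]
  · apply pullback.hom_ext
    · rw [Category.assoc, pullback.lift_fst, reassoc_of% hu, hφ₁, kernel.lift_ι]
    · rw [Category.assoc, pullback.lift_snd, reassoc_of% hw, hψ₁, kernel.lift_ι]
  · apply pullback.hom_ext
    · rw [Category.assoc, pullback.lift_fst, reassoc_of% hu', hφ₂, Category.comp_id,
        Category.id_comp]
    · rw [Category.assoc, pullback.lift_snd, reassoc_of% hw', hψ₂, Category.comp_id,
        Category.id_comp]

/-- The product of the kernels of `f` and `g` is a kernel of the diagonal of their pullback. -/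
theorem IsKernelOf.prod_pullback {A B X Y Z : C} {f : X ⟶ Y} {g : Z ⟶ Y} {a : A ⟶ X} {b : B ⟶ Z}
    (ha : IsKernelOf a f) (hb : IsKernelOf b g) {m : A ⨯ B ⟶ pullback f g}
    (hm₁ : m ≫ pullback.fst f g = prod.fst ≫ a) (hm₂ : m ≫ pullback.snd f g = prod.snd ≫ b) :
    IsKernelOf m (pullback.fst f g ≫ f) := by
  obtain ⟨wa, ⟨la⟩⟩ := ha
  obtain ⟨wb, ⟨lb⟩⟩ := hb
  have : Mono a := mono_of_isLimit_fork la
  have : Mono b := mono_of_isLimit_fork lb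
  have : Mono m := ⟨fun s t h => by
    ext
    · rw [← cancel_mono a]
      simp only [Category.assoc, ← hm₁, reassoc_of% h]
    · rw [← cancel_mono b]
      simp only [Category.assoc, ← hm₂, reassoc_of% h]⟩
  have lift_of {W : C} (k : W ⟶ pullback f g) (hk : k ≫ pullback.fst f g ≫ f = 0) :
      ∃ l : W ⟶ A ⨯ B, l ≫ m = k := by
    obtain ⟨s, hs⟩ := KernelFork.IsLimit.lift' la (k ≫ pullback.fst f g) (by simpa using hk)
    obtain ⟨t, ht⟩ := KernelFork.IsLimit.lift' lb (k ≫ pullback.snd f g)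
      (by rw [Category.assoc, ← pullback.condition, hk])
    refine ⟨prod.lift s t, pullback.hom_ext ?_ ?_⟩
    · simpa [hm₁, prod.lift_fst_assoc] using hs
    · simpa [hm₂, prod.lift_snd_assoc] using ht
  exact ⟨by rw [reassoc_of% hm₁, wa, comp_zero],
    ⟨KernelFork.IsLimit.ofι' m _ fun k hk => ⟨(lift_of k hk).choose, (lift_of k hk).choose_spec⟩⟩⟩

end Pullback

/-- If `f : X ⟶ Y` and `g : Z ⟶ Y` are central extensions with kernels `a : A ⟶ X` and
`b : B ⟶ Z`, then `h = f ∘ q₁ : X ×_Y Z ⟶ Y` is a central extension, and the unique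
morphism `A ⨯ B ⟶ X ×_Y Z` determined by `q₁ ∘ m = a ∘ π_A` and `q₂ ∘ m = b ∘ π_B` is a
kernel of `h`. -/
theorem statement12 {C : Type u} [Category.{v} C] [HasZeroMorphisms C] [HasZeroObject C]
    [HasFiniteLimits C] [HasBinaryCoproducts C] [SemiAbelian C]
    {A B X Y Z : C} (f : X ⟶ Y) (g : Z ⟶ Y) (a : A ⟶ X) (b : B ⟶ Z)
    (hf : IsCentralExt f) (hg : IsCentralExt g)
    (ha : IsKernelOf a f) (hb : IsKernelOf b g) :
    IsCentralExt (pullback.fst f g ≫ f) ∧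
      ∀ m : A ⨯ B ⟶ pullback f g,
        m ≫ pullback.fst f g = prod.fst ≫ a →
        m ≫ pullback.snd f g = prod.snd ≫ b →
        IsKernelOf m (pullback.fst f g ≫ f) := by
  exact ⟨⟨RegularEpi.nonempty_comp (SemiAbelian.regEpiPullbackStable f g hg.1) hf.1,
    HuqCentral.kernel_pullback SemiAbelian.protomodular hf.2 hg.2⟩,
    fun _ hm₁ hm₂ => ha.prod_pullback hb hm₁ hm₂⟩
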